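/- arXiv:1312.7388 — 9 statements merged into one kernel-verified Lean document; each statement's English description precedes it below -/
import Mathlib

section
/- Let c ∈ (−1, 1) and λ = √(1 − c²). The curve α(s) = (2·arctan((e^{λs} − c)/λ) − c·s, ln(e^{λs} + e^{−λs} − 2c)), s ∈ ℝ, is parametrized by arc length and has constant weighted curvature c: x'(s)y''(s) − x''(s)y'(s) − x'(s) = c for all s ∈ ℝ. -/
open Real

theorem exp_add_exp_neg_sub_pos {c : ℝ} (hc : c < 1) (t : ℝ) :
    0 < exp t + exp (-t) - 2 * c := by
  have hcosh := one_le_cosh t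
  rw [cosh_eq] at hcosh
  linarith

theorem hasDerivAt_exp_add_exp_neg_sub (c l s : ℝ) :
    HasDerivAt (fun s => exp (l * s) + exp (-(l * s)) - 2 * c)
      (l * (exp (l * s) - exp (-(l * s)))) s := by
  have hlin : HasDerivAt (fun s => l * s) l s := by
    simpa using (hasDerivAt_id s).const_mul l
  exact ((hlin.exp.fun_add hlin.fun_neg.exp).sub_const (2 * c)).congr_deriv (by ring)

theorem hasDerivAt_exp_sub_exp_neg (l s : ℝ) :
    HasDerivAt (fun s => l * (exp (l * s) - exp (-(l * s))))
      (l ^ 2 * (exp (l * s) + exp (-(l * s)))) s := by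
  have hlin : HasDerivAt (fun s => l * s) l s := by
    simpa using (hasDerivAt_id s).const_mul l
  exact ((hlin.exp.fun_sub hlin.fun_neg.exp).const_mul l).congr_deriv (by ring)

theorem hasDerivAt_two_mul_arctan_sub {c l : ℝ} (hc : c < 1) (hl : l ≠ 0)
    (hl2 : l ^ 2 = 1 - c ^ 2) (s : ℝ) :
    HasDerivAt (fun s => 2 * arctan ((exp (l * s) - c) / l) - c * s)
      (2 * l ^ 2 / (exp (l * s) + exp (-(l * s)) - 2 * c) - c) s := by
  have hlin : ∀ a : ℝ, HasDerivAt (fun s => a * s) a s := fun a => by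
    simpa using (hasDerivAt_id s).const_mul a
  have hpos := exp_add_exp_neg_sub_pos hc (l * s)
  have hmul : exp (l * s) * exp (-(l * s)) = 1 := by rw [← exp_add]; simp
  have hden : 1 + ((exp (l * s) - c) / l) ^ 2
      = exp (l * s) * (exp (l * s) + exp (-(l * s)) - 2 * c) / l ^ 2 := by
    field_simp
    linear_combination hl2 - hmul
  refine (((((hlin l).exp.sub_const c).div_const l).arctan.const_mul 2).fun_sub
    (hlin c)).congr_deriv ?_
  rw [hden]
  have hexp := exp_pos (l * s)
  field_simp

/-- For `c ∈ (−1, 1)` and `λ = √(1 − c²)`, the curve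
`α(s) = (2·arctan((e^{λs} − c)/λ) − c·s, ln(e^{λs} + e^{−λs} − 2c))` is parametrized by
arc length and has constant weighted curvature `c` with respect to the density `e^y`. -/
theorem constant_weighted_curvature_curve_first (c : ℝ) (hc : c ∈ Set.Ioo (-1 : ℝ) 1) :
    let l : ℝ := Real.sqrt (1 - c ^ 2)
    let x : ℝ → ℝ := fun s => 2 * arctan ((exp (l * s) - c) / l) - c * s
    let y : ℝ → ℝ := fun s => log (exp (l * s) + exp (-(l * s)) - 2 * c)
    ∀ s : ℝ,
      deriv x s ^ 2 + deriv y s ^ 2 = 1 ∧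
      deriv x s * deriv (deriv y) s - deriv (deriv x) s * deriv y s - deriv x s = c := by
  intro l x y s
  obtain ⟨hc1, hc2⟩ := hc
  have hlpos : 0 < 1 - c ^ 2 := by nlinarith
  have hl : l ≠ 0 := (sqrt_pos.2 hlpos).ne'
  have hl2 : l ^ 2 = 1 - c ^ 2 := sq_sqrt hlpos.le
  have hD : ∀ s, exp (l * s) + exp (-(l * s)) - 2 * c ≠ 0 :=
    fun s => (exp_add_exp_neg_sub_pos hc2 _).ne'
  have hx : deriv x = fun s => 2 * l ^ 2 / (exp (l * s) + exp (-(l * s)) - 2 * c) - c :=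
    funext fun s => (hasDerivAt_two_mul_arctan_sub hc2 hl hl2 s).deriv
  have hy : deriv y = fun s => l * (exp (l * s) - exp (-(l * s))) /
      (exp (l * s) + exp (-(l * s)) - 2 * c) :=
    funext fun s => ((hasDerivAt_exp_add_exp_neg_sub c l s).log (hD s)).deriv
  have hxx := (((hasDerivAt_const s (2 * l ^ 2)).fun_div
    (hasDerivAt_exp_add_exp_neg_sub c l s) (hD s)).sub_const c).deriv
  have hyy := ((hasDerivAt_exp_sub_exp_neg l s).fun_div
    (hasDerivAt_exp_add_exp_neg_sub c l s) (hD s)).deriv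
  rw [hx, hy, hxx, hyy]
  have hmul : exp (l * s) * exp (-(l * s)) = 1 := by rw [← exp_add]; simp
  have hDs := hD s
  clear_value l
  clear hx hy hxx hyy x y hD
  beta_reduce
  generalize exp (l * s) = E at *
  generalize exp (-(l * s)) = F at *
  obtain ⟨D, hDeq⟩ : ∃ D, D = E + F - 2 * c := ⟨_, rfl⟩
  rw [← hDeq] at hDs ⊢
  have hunit : (2 * l ^ 2 - c * D) ^ 2 + (l * (E - F)) ^ 2 = D ^ 2 := by
    rw [mul_pow, hl2, hDeq]
    linear_combination (-4 * (1 - c ^ 2)) * hmul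
  have hsecond : l ^ 2 * (E + F) * D - (l * (E - F)) ^ 2 = 2 * l ^ 2 * (2 * l ^ 2 - c * D) := by
    rw [mul_pow, hl2, hDeq]
    linear_combination (4 * (1 - c ^ 2)) * hmul
  constructor
  · field_simp
    linear_combination hunit
  · have hyy : (l ^ 2 * (E + F) * D - l * (E - F) * (l * (E - F))) / D ^ 2
        = 2 * l ^ 2 * (2 * l ^ 2 - c * D) / D ^ 2 := by
      rw [← hsecond]; ring
    rw [hyy]
    field_simp
    linear_combination 2 * l ^ 2 * hunit
end

section
/- Let c ∈ (−1, 1), λ = √(1 − c²), and let α = (x, y) : I → ℝ² be a C² curve on an open interval I, parametrized by arc length, with constant weighted curvature c: x'(s)y''(s) − x''(s)y'(s) − x'(s) = c for all s ∈ I. Then either α is contained in a straight line (necessarily with unit direction (cos θ, sin θ) satisfying cos θ = −c), or there exist s₀ ∈ ℝ and (p, q) ∈ ℝ² such that for all s ∈ I, α(s) − (p, q) equals either (2·arctan((e^{λ(s+s₀)} − c)/λ) − c(s+s₀), ln(e^{λ(s+s₀)} + e^{−λ(s+s₀)} − 2c)) or (−2·arctan((e^{λ(s+s₀)} + c)/λ)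 − c(s+s₀), ln(e^{λ(s+s₀)} + e^{−λ(s+s₀)} + 2c)). -/
open Real

/-- A function with vanishing derivative on an open interval is constant there. -/
lemma eq_of_hasDerivAt_zero_of_ordConnected {I : Set ℝ} (hI : IsOpen I) (hconn : I.OrdConnected)
    {f : ℝ → ℝ} (hf : ∀ s ∈ I, HasDerivAt f 0 s) {a s : ℝ} (ha : a ∈ I) (hs : s ∈ I) :
    f s = f a :=
  hI.is_const_of_deriv_eq_zero hconn.isPreconnected
    (fun t ht => (hf t ht).differentiableAt.differentiableWithinAt)
    (fun t ht => (hf t ht).deriv) hs ha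

/-- Functions with the same derivative on an open interval differ by a constant. -/
lemma exists_sub_eq_of_hasDerivAt_eq {I : Set ℝ} (hI : IsOpen I) (hconn : I.OrdConnected)
    {f g h : ℝ → ℝ} (hf : ∀ s ∈ I, HasDerivAt f (h s) s) (hg : ∀ s ∈ I, HasDerivAt g (h s) s)
    {a : ℝ} (ha : a ∈ I) : ∃ p, ∀ s ∈ I, f s - p = g s := by
  refine ⟨f a - g a, fun s hs => ?_⟩
  have := eq_of_hasDerivAt_zero_of_ordConnected hI hconn (f := fun t => f t - g t)
    (fun t ht => ((hf t ht).sub (hg t ht)).congr_deriv (sub_self _)) ha hs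
  linarith

/-- The Frenet equations of a unit-speed curve with velocity `(u, v)` and constant weighted
curvature `c`, solved for the acceleration. -/
lemma acceleration_eq_of_weighted_curvature {c u v u' v' : ℝ} (hunit : u ^ 2 + v ^ 2 = 1)
    (horth : u * u' + v * v' = 0) (hcurv : u * v' - u' * v - u = c) :
    u' = -v * (u + c) ∧ v' = u * (u + c) := by
  constructor
  · linear_combination (-u') * hunit + u * horth - v * hcurv
  · linear_combination (-v') * hunit + v * horth + u * hcurv

lemma exists_cos_eq_sin_eq {a b : ℝ} (h : a ^ 2 + b ^ 2 = 1) :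
    ∃ θ : ℝ, cos θ = a ∧ sin θ = b := by
  have hn : ‖(⟨a, b⟩ : ℂ)‖ = 1 := by
    rw [Complex.norm_eq_sqrt_sq_add_sq, h, Real.sqrt_one]
  have h0 : (⟨a, b⟩ : ℂ) ≠ 0 := by
    intro h0
    rw [h0, norm_zero] at hn
    exact zero_ne_one hn
  exact ⟨Complex.arg ⟨a, b⟩, by rw [Complex.cos_arg h0, hn, div_one],
    by rw [Complex.sin_arg, hn, div_one]⟩

/-- If `x' + c > 0` along the curve, then the curve is a translate of the first model curve. -/
lemma exists_eq_model_of_deriv_add_pos {c : ℝ} (hc : c ∈ Set.Ioo (-1 : ℝ) 1) {I : Set ℝ}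
    (hI : IsOpen I) (hconn : I.OrdConnected) {a : ℝ} (ha : a ∈ I) {x y u v : ℝ → ℝ}
    (hx : ∀ s ∈ I, HasDerivAt x (u s) s) (hy : ∀ s ∈ I, HasDerivAt y (v s) s)
    (hu : ∀ s ∈ I, HasDerivAt u (-v s * (u s + c)) s)
    (hv : ∀ s ∈ I, HasDerivAt v (u s * (u s + c)) s)
    (hunit : ∀ s ∈ I, u s ^ 2 + v s ^ 2 = 1) (hpos : ∀ s ∈ I, 0 < u s + c) :
    ∃ s₀ p q : ℝ, ∀ s ∈ I,
      x s - p = 2 * arctan ((exp (Real.sqrt (1 - c ^ 2) * (s + s₀)) - c) /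
          Real.sqrt (1 - c ^ 2)) - c * (s + s₀) ∧
      y s - q = log (exp (Real.sqrt (1 - c ^ 2) * (s + s₀)) +
          exp (-(Real.sqrt (1 - c ^ 2) * (s + s₀))) - 2 * c) := by
  obtain ⟨hc1, hc2⟩ := hc
  have hl2 : 0 < 1 - c ^ 2 := by nlinarith
  set l := Real.sqrt (1 - c ^ 2)
  have hlpos : 0 < l := Real.sqrt_pos.2 hl2
  have hlsq : l ^ 2 = 1 - c ^ 2 := Real.sq_sqrt hl2.le
  -- The quotients `(l² + c w ± l v) / w`, with `w = u + c`, are mutually inverse exponentials.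
  have hprod : ∀ s ∈ I, (l ^ 2 + c * (u s + c) + l * v s) * (l ^ 2 + c * (u s + c) - l * v s)
      = (u s + c) ^ 2 := by
    intro s hs
    have h := hunit s hs
    linear_combination (-l ^ 2) * h + (l ^ 2 + 2 * c * (u s + c) + u s ^ 2 - c ^ 2) * hlsq
  have hplus : ∀ s ∈ I, 0 < l ^ 2 + c * (u s + c) + l * v s := by
    intro s hs
    have h := hunit s hs
    have hw := hpos s hs
    have hu2 : u s ^ 2 ≤ 1 := by nlinarith [sq_nonneg (v s)]
    have hsum : 0 < l ^ 2 + c * (u s + c) := by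
      have : 0 < 1 + c * u s := by nlinarith [sq_nonneg (c + u s)]
      nlinarith
    by_contra hneg
    push Not at hneg
    have : 0 < l ^ 2 + c * (u s + c) - l * v s := by linarith
    nlinarith [hprod s hs, pow_pos hw 2]
  let P : ℝ → ℝ := fun s => exp (-(l * s)) * ((l ^ 2 + c * (u s + c) + l * v s) / (u s + c))
  have hP : ∀ s ∈ I, HasDerivAt P 0 s := by
    intro s hs
    have hw := (hpos s hs).ne'
    have hwd := (hu s hs).add_const c
    have hd := (((hasDerivAt_id s).const_mul l).neg.exp).mul
      ((((hwd.const_mul c).const_add (l ^ 2)).add ((hv s hs).const_mul l)).div hwd hw)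
    refine hd.congr_deriv ?_
    simp only [id, Pi.add_apply, Pi.neg_apply, Pi.div_apply]
    field_simp
    linear_combination exp (-(l * s)) * l * (hunit s hs - hlsq)
  obtain ⟨s₀, hs₀⟩ : ∃ s₀, exp (l * s₀) = P a :=
    ⟨log (P a) / l, by
      rw [mul_div_cancel₀ _ hlpos.ne',
        exp_log (mul_pos (exp_pos _) (div_pos (hplus a ha) (hpos a ha)))]⟩
  have hE : ∀ s ∈ I, exp (l * (s + s₀)) = (l ^ 2 + c * (u s + c) + l * v s) / (u s + c) := by
    intro s hs
    rw [mul_add, exp_add, hs₀, ← eq_of_hasDerivAt_zero_of_ordConnected hI hconn hP ha hs]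
    simp only [P]
    rw [← mul_assoc, ← exp_add, add_neg_cancel, exp_zero, one_mul]
  have hE' : ∀ s ∈ I, exp (-(l * (s + s₀))) =
      (l ^ 2 + c * (u s + c) - l * v s) / (u s + c) := by
    intro s hs
    have hw := (hpos s hs).ne'
    have hp := (hplus s hs).ne'
    rw [exp_neg, hE s hs, inv_div, div_eq_div_iff hp hw]
    linear_combination -hprod s hs
  have hden : ∀ s ∈ I, exp (l * (s + s₀)) + exp (-(l * (s + s₀))) - 2 * c =
      2 * l ^ 2 / (u s + c) := by
    intro s hs
    have hw := (hpos s hs).ne'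
    rw [hE s hs, hE' s hs]
    field_simp
    ring
  have hX : ∀ s ∈ I, HasDerivAt
      (fun s => 2 * arctan ((exp (l * (s + s₀)) - c) / l) - c * (s + s₀)) (u s) s := by
    intro s hs
    have hw := (hpos s hs).ne'
    have hlin := (hasDerivAt_id s).add_const s₀
    have hd := (((((hlin.const_mul l).exp.sub_const c).div_const l).arctan).const_mul 2).sub
      (hlin.const_mul c)
    refine hd.congr_deriv ?_
    have hdens := hden s hs
    simp only [id]
    rw [exp_neg] at hdens
    have hEpos := exp_pos (l * (s + s₀))
    generalize exp (l * (s + s₀)) = E at hdens hEpos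
    have hq : 0 < l ^ 2 + (E - c) ^ 2 := by positivity
    field_simp at hdens ⊢
    linear_combination -hdens - (u s + c) * hlsq
  have hY : ∀ s ∈ I, HasDerivAt
      (fun s => -log (u s + c)) (v s) s := by
    intro s hs
    have hw := (hpos s hs).ne'
    have hd := (((hu s hs).add_const c).log hw).neg
    refine hd.congr_deriv ?_
    field_simp
  obtain ⟨p, hp⟩ := exists_sub_eq_of_hasDerivAt_eq hI hconn hx hX ha
  obtain ⟨q, hq⟩ := exists_sub_eq_of_hasDerivAt_eq hI hconn hy hY ha
  refine ⟨s₀, p, q - log (2 * l ^ 2), fun s hs => ⟨hp s hs, ?_⟩⟩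
  rw [hden s hs, log_div (by positivity) (hpos s hs).ne']
  linarith [hq s hs]

/-- Classification of curves of constant weighted curvature `c ∈ (−1, 1)` in the plane
with density `e^y`: such a unit-speed `C²` curve is either contained in a straight line
with direction `(cos θ, sin θ)`, `cos θ = −c`, or is a translate (with parameter shift) of
one of the two explicit curves. -/
theorem constant_weighted_curvature_classification_small (c : ℝ)
    (hc : c ∈ Set.Ioo (-1 : ℝ) 1) (I : Set ℝ) (hI : IsOpen I) (hconn : I.OrdConnected)
    (x y : ℝ → ℝ) (hx : ContDiffOn ℝ 2 x I) (hy : ContDiffOn ℝ 2 y I)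
    (harc : ∀ s ∈ I, deriv x s ^ 2 + deriv y s ^ 2 = 1)
    (hcurv : ∀ s ∈ I,
      deriv x s * deriv (deriv y) s - deriv (deriv x) s * deriv y s - deriv x s = c) :
    (∃ θ p q : ℝ, cos θ = -c ∧ ∀ s ∈ I, x s = p + s * cos θ ∧ y s = q + s * sin θ) ∨
    (∃ s₀ p q : ℝ,
      (∀ s ∈ I,
        x s - p = 2 * arctan ((exp (Real.sqrt (1 - c ^ 2) * (s + s₀)) - c) /
            Real.sqrt (1 - c ^ 2)) - c * (s + s₀) ∧
        y s - q = log (exp (Real.sqrt (1 - c ^ 2) * (s + s₀)) +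
            exp (-(Real.sqrt (1 - c ^ 2) * (s + s₀))) - 2 * c)) ∨
      (∀ s ∈ I,
        x s - p = -2 * arctan ((exp (Real.sqrt (1 - c ^ 2) * (s + s₀)) + c) /
            Real.sqrt (1 - c ^ 2)) - c * (s + s₀) ∧
        y s - q = log (exp (Real.sqrt (1 - c ^ 2) * (s + s₀)) +
            exp (-(Real.sqrt (1 - c ^ 2) * (s + s₀))) + 2 * c))) := by
  rcases I.eq_empty_or_nonempty with rfl | ⟨a, ha⟩
  · exact Or.inr ⟨0, 0, 0, Or.inl fun s hs => hs.elim⟩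
  have hxd : ∀ s ∈ I, HasDerivAt x (deriv x s) s := fun s hs =>
    ((hx.contDiffAt (hI.mem_nhds hs)).differentiableAt two_ne_zero).hasDerivAt
  have hyd : ∀ s ∈ I, HasDerivAt y (deriv y s) s := fun s hs =>
    ((hy.contDiffAt (hI.mem_nhds hs)).differentiableAt two_ne_zero).hasDerivAt
  have hxdd : ∀ s ∈ I, HasDerivAt (deriv x) (deriv (deriv x) s) s := fun s hs =>
    ((((contDiffOn_succ_iff_deriv_of_isOpen (n := 1) hI).1 hx).2.2.contDiffAt
      (hI.mem_nhds hs)).differentiableAt one_ne_zero).hasDerivAt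
  have hydd : ∀ s ∈ I, HasDerivAt (deriv y) (deriv (deriv y) s) s := fun s hs =>
    ((((contDiffOn_succ_iff_deriv_of_isOpen (n := 1) hI).1 hy).2.2.contDiffAt
      (hI.mem_nhds hs)).differentiableAt one_ne_zero).hasDerivAt
  have hacc : ∀ s ∈ I, deriv (deriv x) s = -deriv y s * (deriv x s + c) ∧
      deriv (deriv y) s = deriv x s * (deriv x s + c) := by
    intro s hs
    refine acceleration_eq_of_weighted_curvature (harc s hs) ?_ (hcurv s hs)
    have hconst : HasDerivAt (fun t => deriv x t ^ 2 + deriv y t ^ 2) 0 s :=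
      (hasDerivAt_const s (1 : ℝ)).congr_of_eventuallyEq
        (Filter.eventuallyEq_of_mem (hI.mem_nhds hs) harc)
    have h := (((hxdd s hs).pow 2).add ((hydd s hs).pow 2)).unique hconst
    norm_num at h
    linarith
  have hu : ∀ s ∈ I, HasDerivAt (deriv x) (-deriv y s * (deriv x s + c)) s := fun s hs =>
    (hacc s hs).1 ▸ hxdd s hs
  have hv : ∀ s ∈ I, HasDerivAt (deriv y) (deriv x s * (deriv x s + c)) s := fun s hs =>
    (hacc s hs).2 ▸ hydd s hs
  -- `(x' + c) e^y` is a first integral.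
  have hK : ∀ s ∈ I, (deriv x s + c) * exp (y s) = (deriv x a + c) * exp (y a) := fun s hs =>
    eq_of_hasDerivAt_zero_of_ordConnected hI hconn
      (f := fun t => (deriv x t + c) * exp (y t)) (fun t ht =>
        (((hu t ht).add_const c).mul (hyd t ht).exp).congr_deriv (by ring)) ha hs
  rcases lt_trichotomy (deriv x a + c) 0 with hneg | hzero | hpos
  · right
    -- Reflecting `x` and `c` reduces to the case of positive `x' + c`.
    have hneg' : ∀ s ∈ I, 0 < -deriv x s + -c := fun s hs => by
      have h := hK s hs ▸ mul_neg_of_neg_of_pos hneg (exp_pos (y a))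
      linarith [neg_of_mul_neg_left h (exp_pos (y s)).le]
    obtain ⟨s₀, p, q, h⟩ := exists_eq_model_of_deriv_add_pos (c := -c)
      ⟨by linarith [hc.2], by linarith [hc.1]⟩ hI hconn ha (x := fun s => -x s)
      (u := fun s => -deriv x s) (v := deriv y) (fun s hs => (hxd s hs).neg) hyd
      (fun s hs => (hu s hs).neg.congr_deriv (by ring))
      (fun s hs => (hv s hs).congr_deriv (by ring))
      (fun s hs => by rw [neg_sq]; exact harc s hs) hneg'
    refine ⟨s₀, -p, q, Or.inr fun s hs => ?_⟩
    have h' := h s hs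
    simp only [neg_sq, sub_neg_eq_add, mul_neg] at h'
    exact ⟨by linarith [h'.1], h'.2⟩
  · left
    have hux : ∀ s ∈ I, deriv x s + c = 0 := fun s hs => by
      have h := hK s hs
      rw [hzero, zero_mul] at h
      exact (mul_eq_zero.1 h).resolve_right (exp_pos _).ne'
    have hvy : ∀ s ∈ I, deriv y s = deriv y a := fun s hs =>
      eq_of_hasDerivAt_zero_of_ordConnected hI hconn
        (fun t ht => by simpa [hux t ht] using hv t ht) ha hs
    obtain ⟨θ, hcos, hsin⟩ := exists_cos_eq_sin_eq (harc a ha)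
    have hlin : ∀ b s : ℝ, HasDerivAt (fun t => t * b) b s := fun b s => by
      simpa using (hasDerivAt_id s).mul_const b
    obtain ⟨p, hp⟩ := exists_sub_eq_of_hasDerivAt_eq hI hconn (h := fun _ => cos θ)
      (fun s hs => by
        have : deriv x s = cos θ := by linarith [hux s hs]
        exact this ▸ hxd s hs) (fun s _ => hlin (cos θ) s) ha
    obtain ⟨q, hq⟩ := exists_sub_eq_of_hasDerivAt_eq hI hconn (h := fun _ => sin θ)
      (fun s hs => by
        have : deriv y s = sin θ := by rw [hvy s hs, hsin]
        exact this ▸ hyd s hs) (fun s _ => hlin (sin θ) s) ha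
    exact ⟨θ, p, q, by linarith, fun s hs => ⟨by linarith [hp s hs], by linarith [hq s hs]⟩⟩
  · right
    obtain ⟨s₀, p, q, h⟩ := exists_eq_model_of_deriv_add_pos hc hI hconn ha hxd hyd hu hv harc
      (fun s hs => pos_of_mul_pos_left (hK s hs ▸ mul_pos hpos (exp_pos (y a)))
        (exp_pos (y s)).le)
    exact ⟨s₀, p, q, Or.inl h⟩
end

section
/- The curve α(s) = (2·arctan(s) − s, ln(1 + s²)), s ∈ ℝ, is parametrized by arc length and has constant weighted curvature 1: x'(s)y''(s) − x''(s)y'(s) − x'(s) = 1 for all s. The curve β(s) = (−2·arctan(s) + s, ln(1 + s²)), s ∈ ℝ, is parametrized by arc length and has constant weighted curvature −1. Moreover β(s) = α(−s) for all s, so α and β have the same trace with opposite orientations. -/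
open Real

theorem hasDerivAt_one_add_sq (s : ℝ) : HasDerivAt (fun t : ℝ => 1 + t ^ 2) (2 * s) s := by
  simpa using ((hasDerivAt_id s).pow 2).const_add 1

theorem deriv_two_mul_arctan_sub_id :
    deriv (fun s : ℝ => 2 * arctan s - s) = fun s => 2 / (1 + s ^ 2) - 1 := by
  funext s
  have h := ((hasDerivAt_arctan s).const_mul 2).sub (hasDerivAt_id s)
  exact h.deriv.trans (by ring)

theorem deriv_log_one_add_sq :
    deriv (fun s : ℝ => log (1 + s ^ 2)) = fun s => 2 * s / (1 + s ^ 2) := by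
  funext s
  have hs : 1 + s ^ 2 ≠ 0 := by positivity
  exact ((hasDerivAt_one_add_sq s).log hs).deriv

theorem deriv_two_div_one_add_sq_sub_one (s : ℝ) :
    deriv (fun t : ℝ => 2 / (1 + t ^ 2) - 1) s = -(4 * s) / (1 + s ^ 2) ^ 2 := by
  have hs : 1 + s ^ 2 ≠ 0 := by positivity
  have h := ((hasDerivAt_const s (2 : ℝ)).div (hasDerivAt_one_add_sq s) hs).sub_const 1
  exact h.deriv.trans (by ring)

theorem deriv_two_mul_div_one_add_sq (s : ℝ) :
    deriv (fun t : ℝ => 2 * t / (1 + t ^ 2)) s = (2 - 2 * s ^ 2) / (1 + s ^ 2) ^ 2 := by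
  have hs : 1 + s ^ 2 ≠ 0 := by positivity
  have h := ((hasDerivAt_id s).const_mul 2).div (hasDerivAt_one_add_sq s) hs
  exact h.deriv.trans (by simp only [id]; ring)

/-- The curve `α(s) = (2·arctan s − s, ln(1 + s²))` is unit-speed with constant weighted
curvature `1`, the curve `β(s) = (−2·arctan s + s, ln(1 + s²))` is unit-speed with constant
weighted curvature `−1`, and `β(s) = α(−s)`, so they have the same trace with opposite
orientations. -/
theorem weighted_curvature_pm_one_curves :
    let x : ℝ → ℝ := fun s => 2 * arctan s - s
    let y : ℝ → ℝ := fun s => log (1 + s ^ 2)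
    let xb : ℝ → ℝ := fun s => -2 * arctan s + s
    let yb : ℝ → ℝ := fun s => log (1 + s ^ 2)
    (∀ s : ℝ,
      deriv x s ^ 2 + deriv y s ^ 2 = 1 ∧
      deriv x s * deriv (deriv y) s - deriv (deriv x) s * deriv y s - deriv x s = 1) ∧
    (∀ s : ℝ,
      deriv xb s ^ 2 + deriv yb s ^ 2 = 1 ∧
      deriv xb s * deriv (deriv yb) s - deriv (deriv xb) s * deriv yb s - deriv xb s
        = -1) ∧
    (∀ s : ℝ, (xb s, yb s) = (x (-s), y (-s))) := by
  intro x y xb yb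
  have hxb : xb = -x := by
    funext s
    simp only [xb, x, Pi.neg_apply]
    ring
  have hα : ∀ s : ℝ,
      deriv x s ^ 2 + deriv y s ^ 2 = 1 ∧
      deriv x s * deriv (deriv y) s - deriv (deriv x) s * deriv y s - deriv x s = 1 := by
    intro s
    have hs : 1 + s ^ 2 ≠ 0 := by positivity
    simp only [x, y, deriv_two_mul_arctan_sub_id, deriv_log_one_add_sq,
      deriv_two_div_one_add_sq_sub_one, deriv_two_mul_div_one_add_sq]
    constructor <;> field_simp <;> ring
  refine ⟨hα, fun s => ?_, fun s => ?_⟩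
  · obtain ⟨hspeed, hcurv⟩ := hα s
    have hd : deriv xb = -deriv x := by
      funext t
      rw [hxb, deriv.neg, Pi.neg_apply]
    have hdd : deriv (deriv xb) s = -deriv (deriv x) s := by rw [hd, deriv.neg]
    rw [hdd, hd, Pi.neg_apply, show yb = y from rfl]
    exact ⟨by linear_combination hspeed, by linear_combination -hcurv⟩
  · simp only [x, y, xb, yb, arctan_neg, neg_sq, Prod.mk.injEq, and_true]
    ring
end

section
/- Let α = (x, y) : I → ℝ² be a C² curve on an open interval I, parametrized by arc length, with constant weighted curvature 1: x'(s)y''(s) − x''(s)y'(s) − x'(s) = 1 for all s ∈ I. Then either α is contained in a horizontal line traversed in the negative x-direction (x(s) = −s + const, y constant), or there exist s₀ ∈ ℝ and (p, q) ∈ ℝ² such that α(s) = (p + 2·arctan(s + s₀) − (s + s₀), q + ln(1 + (s + s₀)²)) for all s ∈ I. -/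
open Real

/-- A function with vanishing derivative on an open order-connected set is constant there. -/
theorem exists_eq_const_of_hasDerivAt_zero {I : Set ℝ} (hI : IsOpen I) (hconn : I.OrdConnected)
    {f : ℝ → ℝ} (hf : ∀ s ∈ I, HasDerivAt f 0 s) : ∃ c, ∀ s ∈ I, f s = c :=
  hI.exists_is_const_of_deriv_eq_zero hconn.isPreconnected
    (fun s hs => (hf s hs).differentiableAt.differentiableWithinAt) (fun s hs => (hf s hs).deriv)

/-- A function that is `C²` on an open set has a derivative and a second derivative there. -/
theorem ContDiffOn.hasDerivAt_deriv_deriv {I : Set ℝ} (hI : IsOpen I) {f : ℝ → ℝ}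
    (hf : ContDiffOn ℝ 2 f I) {s : ℝ} (hs : s ∈ I) :
    HasDerivAt f (deriv f s) s ∧ HasDerivAt (deriv f) (deriv (deriv f) s) s := by
  have hf' : ContDiffOn ℝ 1 (deriv f) I := hf.deriv_of_isOpen hI (by norm_num)
  exact ⟨((hf.differentiableOn (by norm_num)).differentiableAt (hI.mem_nhds hs)).hasDerivAt,
    ((hf'.differentiableOn (by norm_num)).differentiableAt (hI.mem_nhds hs)).hasDerivAt⟩

/-- Classification of unit-speed curves of constant weighted curvature `1` in the plane
with density `e^y`: such a curve is either a horizontal line traversed in the negative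
`x`-direction, or a translate (with parameter shift) of
`s ↦ (2·arctan s − s, ln(1 + s²))`. -/
theorem weighted_curvature_one_classification (I : Set ℝ) (hI : IsOpen I)
    (hconn : I.OrdConnected) (x y : ℝ → ℝ)
    (hx : ContDiffOn ℝ 2 x I) (hy : ContDiffOn ℝ 2 y I)
    (harc : ∀ s ∈ I, deriv x s ^ 2 + deriv y s ^ 2 = 1)
    (hcurv : ∀ s ∈ I,
      deriv x s * deriv (deriv y) s - deriv (deriv x) s * deriv y s - deriv x s = 1) :
    (∃ p q : ℝ, ∀ s ∈ I, x s = -s + p ∧ y s = q) ∨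
    (∃ s₀ p q : ℝ, ∀ s ∈ I,
      x s = p + 2 * arctan (s + s₀) - (s + s₀) ∧
      y s = q + log (1 + (s + s₀) ^ 2)) := by
  have hx₁ s (hs : s ∈ I) := (hx.hasDerivAt_deriv_deriv hI hs).1
  have hy₁ s (hs : s ∈ I) := (hy.hasDerivAt_deriv_deriv hI hs).1
  have hx₂ s (hs : s ∈ I) := (hx.hasDerivAt_deriv_deriv hI hs).2
  have hy₂ s (hs : s ∈ I) := (hy.hasDerivAt_deriv_deriv hI hs).2
  have horth : ∀ s ∈ I,
      deriv x s * deriv (deriv x) s + deriv y s * deriv (deriv y) s = 0 := by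
    intro s hs
    have hsum := ((hx₂ s hs).pow 2).add ((hy₂ s hs).pow 2)
    have hconst : HasDerivAt (deriv x ^ 2 + deriv y ^ 2) 0 s :=
      (hasDerivAt_const s (1 : ℝ)).congr_of_eventuallyEq
        (Filter.eventually_of_mem (hI.mem_nhds hs) harc)
    have huniq := hsum.unique hconst
    norm_num at huniq
    linarith
  have hxx : ∀ s ∈ I, deriv (deriv x) s = -deriv y s * (1 + deriv x s) := by
    intro s hs
    linear_combination deriv x s * horth s hs - deriv y s * hcurv s hs
      - deriv (deriv x) s * harc s hs
  have hyy : ∀ s ∈ I, deriv (deriv y) s = deriv x s * (1 + deriv x s) := by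
    intro s hs
    linear_combination deriv y s * horth s hs + deriv x s * hcurv s hs
      - deriv (deriv y) s * harc s hs
  -- `(1 + x') e^y` is a first integral.
  obtain ⟨c, hc⟩ : ∃ c, ∀ s ∈ I, (1 + deriv x s) * exp (y s) = c := by
    refine exists_eq_const_of_hasDerivAt_zero hI hconn fun s hs => ?_
    refine (((hx₂ s hs).const_add 1).mul (hy₁ s hs).exp).congr_deriv ?_
    rw [hxx s hs]
    ring
  by_cases hc0 : c = 0
  · left
    have hx' : ∀ s ∈ I, deriv x s = -1 := by
      intro s hs
      have hprod := hc s hs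
      rw [hc0, mul_eq_zero, or_iff_left (exp_pos _).ne'] at hprod
      linarith
    have hy' : ∀ s ∈ I, deriv y s = 0 := by
      intro s hs
      have hsq := harc s hs
      rw [hx' s hs] at hsq
      exact pow_eq_zero_iff two_ne_zero |>.1 (by linarith)
    obtain ⟨p, hp⟩ : ∃ p, ∀ s ∈ I, x s + s = p := by
      refine exists_eq_const_of_hasDerivAt_zero hI hconn fun s hs => ?_
      refine ((hx₁ s hs).add (hasDerivAt_id s)).congr_deriv ?_
      rw [hx' s hs]
      norm_num
    obtain ⟨q, hq⟩ : ∃ q, ∀ s ∈ I, y s = q :=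
      exists_eq_const_of_hasDerivAt_zero hI hconn fun s hs => hy' s hs ▸ hy₁ s hs
    exact ⟨p, q, fun s hs => ⟨by linarith [hp s hs], hq s hs⟩⟩
  · right
    have hne : ∀ s ∈ I, 1 + deriv x s ≠ 0 := by
      intro s hs h0
      exact hc0 (by rw [← hc s hs, h0, zero_mul])
    obtain ⟨s₀, hs₀⟩ : ∃ s₀, ∀ s ∈ I, deriv y s / (1 + deriv x s) - s = s₀ := by
      refine exists_eq_const_of_hasDerivAt_zero hI hconn fun s hs => ?_
      refine (((hy₂ s hs).div ((hx₂ s hs).const_add 1) (hne s hs)).sub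
        (hasDerivAt_id s)).congr_deriv ?_
      have h0 := hne s hs
      rw [hxx s hs, hyy s hs]
      field_simp
      linear_combination harc s hs
    have hy' : ∀ s ∈ I, deriv y s = (s + s₀) * (1 + deriv x s) := by
      intro s hs
      rw [← hs₀ s hs]
      field_simp [hne s hs]
      ring
    have hu : ∀ s ∈ I, (1 + deriv x s) * (1 + (s + s₀) ^ 2) = 2 := by
      intro s hs
      refine mul_left_cancel₀ (hne s hs) ?_
      have hsq := harc s hs
      rw [hy' s hs] at hsq
      linear_combination hsq
    have hpos (s : ℝ) : 1 + (s + s₀) ^ 2 ≠ 0 := by positivity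
    have hshift (s : ℝ) : HasDerivAt (fun r => r + s₀) 1 s := (hasDerivAt_id s).add_const s₀
    obtain ⟨p, hp⟩ : ∃ p, ∀ s ∈ I, x s - (2 * arctan (s + s₀) - (s + s₀)) = p := by
      refine exists_eq_const_of_hasDerivAt_zero hI hconn fun s hs => ?_
      refine ((hx₁ s hs).sub (((hshift s).arctan.const_mul 2).sub (hshift s))).congr_deriv ?_
      have h0 := hpos s
      field_simp
      linear_combination hu s hs
    obtain ⟨q, hq⟩ : ∃ q, ∀ s ∈ I, y s - log (1 + (s + s₀) ^ 2) = q := by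
      refine exists_eq_const_of_hasDerivAt_zero hI hconn fun s hs => ?_
      refine ((hy₁ s hs).sub ((((hshift s).pow 2).const_add 1).log (hpos s))).congr_deriv ?_
      have h0 := hpos s
      rw [hy' s hs]
      norm_num
      field_simp
      linear_combination (s + s₀) * hu s hs
    exact ⟨s₀, p, q, fun s hs => ⟨by linarith [hp s hs], by linarith [hq s hs]⟩⟩
end

section
/- Let c ∈ ℝ with |c| > 1, let ε = 1 if c > 1 and ε = −1 if c < −1, and let μ = √(c² − 1). The curve α(s) = (2ε·arctan(√((c−1)/(c+1))·tan(μs/2)) − c·s, −ln((tan²(μs/2) + 1)/(((c−1)/(c+1))·tan²(μs/2) + 1))) defined for s ∈ (−π/μ, π/μ) is parametrized by arc length and has constant weighted curvature c: x'(s)y''(s) − x''(s)y'(s) − x'(s) = c for all s ∈ (−π/μ, π/μ). -/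
open Real

/-- A number of absolute value greater than one cannot be cancelled by a cosine. -/
lemma add_cos_ne_zero_of_one_lt_abs {c : ℝ} (hc : 1 < |c|) (θ : ℝ) : c + cos θ ≠ 0 := by
  intro h
  have hcos : c = -cos θ := by linarith
  rw [hcos, abs_neg] at hc
  exact absurd (abs_cos_le_one θ) (not_le.mpr hc)

/-- For `1 < |c|`, the number `√((c - 1) / (c + 1)) * √(c ^ 2 - 1)` is `c - 1` up to the sign
of `c`. -/
lemma sign_mul_sqrt_div_mul_sqrt {c : ℝ} (hc : 1 < |c|) :
    (if 1 < c then (1 : ℝ) else -1) * (√((c - 1) / (c + 1)) * √(c ^ 2 - 1)) = c - 1 := by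
  have hq : 0 < c ^ 2 - 1 := by
    have := (one_lt_sq_iff_one_lt_abs c).mpr hc
    linarith
  have hc1 : c + 1 ≠ 0 := by
    intro h
    nlinarith
  have hmul : (c - 1) / (c + 1) * (c ^ 2 - 1) = (c - 1) ^ 2 := by
    field_simp
    ring
  rw [← sqrt_mul' _ hq.le, hmul, sqrt_sq_eq_abs]
  split_ifs with h
  · rw [abs_of_pos (by linarith)]
    ring
  · rw [abs_of_nonpos (by linarith)]
    ring

/-- The half-angle substitution for `c + cos θ`. -/
lemma tan_half_sq_add_one_div {c θ : ℝ} (hc : 1 < |c|) (hθ : cos (θ / 2) ≠ 0) :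
    (tan (θ / 2) ^ 2 + 1) / ((c - 1) / (c + 1) * tan (θ / 2) ^ 2 + 1) =
      (c + 1) / (c + cos θ) := by
  have hcos := add_cos_ne_zero_of_one_lt_abs hc θ
  have hc1 : c + 1 ≠ 0 := by simpa using add_cos_ne_zero_of_one_lt_abs hc 0
  have hdouble : cos θ = 2 * cos (θ / 2) ^ 2 - 1 := by
    rw [← cos_two_mul, mul_div_cancel₀ θ two_ne_zero]
  have hsq := sin_sq_add_cos_sq (θ / 2)
  have hden : (c - 1) / (c + 1) * tan (θ / 2) ^ 2 + 1 =
      (c + cos θ) / ((c + 1) * cos (θ / 2) ^ 2) := by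
    rw [tan_eq_sin_div_cos, hdouble]
    field_simp
    linear_combination (c - 1) * hsq
  have hnum : tan (θ / 2) ^ 2 + 1 = 1 / cos (θ / 2) ^ 2 := by
    rw [tan_eq_sin_div_cos]
    field_simp
    linear_combination hsq
  rw [hden, hnum]
  field_simp

lemma hasDerivAt_mul_arctan_mul_tan_half {c μ s : ℝ} (hc : 1 < |c|)
    (hμ : μ = √(c ^ 2 - 1)) (hs : cos (μ * s / 2) ≠ 0) :
    HasDerivAt
      (fun s => 2 * (if 1 < c then (1 : ℝ) else -1) *
        arctan (√((c - 1) / (c + 1)) * tan (μ * s / 2)) - c * s)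
      (μ ^ 2 / (c + cos (μ * s)) - c) s := by
  have hq : 0 < c ^ 2 - 1 := by
    have := (one_lt_sq_iff_one_lt_abs c).mpr hc
    linarith
  have hc1 : c + 1 ≠ 0 := by simpa using add_cos_ne_zero_of_one_lt_abs hc 0
  have hr : 0 ≤ (c - 1) / (c + 1) := by
    have : (c - 1) / (c + 1) = (c ^ 2 - 1) / (c + 1) ^ 2 := by
      field_simp
      ring
    rw [this]
    positivity
  have hlin : HasDerivAt (fun s : ℝ => μ * s / 2) (μ / 2) s := by
    simpa using ((hasDerivAt_id s).const_mul μ).div_const 2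
  have h := ((((hasDerivAt_tan hs).comp s hlin).const_mul
    (√((c - 1) / (c + 1)))).arctan.const_mul (2 * (if 1 < c then (1 : ℝ) else -1))).sub
    ((hasDerivAt_id s).const_mul c)
  refine h.congr_deriv ?_
  have hkey := sign_mul_sqrt_div_mul_sqrt hc
  rw [← hμ] at hkey
  have htan := tan_half_sq_add_one_div hc hs
  have hμsq : μ ^ 2 = (c - 1) * (c + 1) := by
    rw [hμ, sq_sqrt hq.le]
    ring
  have hsec : 1 / cos (μ * s / 2) ^ 2 = tan (μ * s / 2) ^ 2 + 1 := by
    rw [← inv_one_add_tan_sq hs, one_div, inv_inv, add_comm]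
  simp only [Function.comp_apply, mul_one, hsec, mul_pow, sq_sqrt hr]
  rw [hμsq]
  linear_combination (tan (μ * s / 2) ^ 2 + 1) /
    ((c - 1) / (c + 1) * tan (μ * s / 2) ^ 2 + 1) * hkey + (c - 1) * htan

lemma hasDerivAt_neg_log_tan_half {c μ s : ℝ} (hc : 1 < |c|) (hs : cos (μ * s / 2) ≠ 0) :
    HasDerivAt
      (fun s => -log ((tan (μ * s / 2) ^ 2 + 1) /
        ((c - 1) / (c + 1) * tan (μ * s / 2) ^ 2 + 1)))
      (-(μ * sin (μ * s)) / (c + cos (μ * s))) s := by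
  have hc1 : c + 1 ≠ 0 := by simpa using add_cos_ne_zero_of_one_lt_abs hc 0
  have hden := add_cos_ne_zero_of_one_lt_abs hc (μ * s)
  have hev : (fun s => -log ((tan (μ * s / 2) ^ 2 + 1) /
      ((c - 1) / (c + 1) * tan (μ * s / 2) ^ 2 + 1))) =ᶠ[nhds s]
      fun s => log (c + cos (μ * s)) - log (c + 1) := by
    have hcont : ContinuousAt (fun s : ℝ => cos (μ * s / 2)) s := by fun_prop
    filter_upwards [hcont.eventually_ne hs] with u hu
    rw [tan_half_sq_add_one_div hc hu,
      log_div hc1 (add_cos_ne_zero_of_one_lt_abs hc _), neg_sub]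
  refine HasDerivAt.congr_of_eventuallyEq ?_ hev
  have hlin : HasDerivAt (fun s : ℝ => μ * s) μ s := by
    simpa using (hasDerivAt_id s).const_mul μ
  refine (((hlin.cos.const_add c).log hden).sub_const _).congr_deriv ?_
  ring

/-- For `|c| > 1`, with `ε = ±1` according to the sign of `c` and `μ = √(c² − 1)`, the
curve `α(s) = (2ε·arctan(√((c−1)/(c+1))·tan(μs/2)) − c·s,
−ln((tan²(μs/2)+1)/(((c−1)/(c+1))·tan²(μs/2)+1)))` on `(−π/μ, π/μ)` is parametrized by arc
length and has constant weighted curvature `c` with respect to the density `e^y`. -/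
theorem constant_weighted_curvature_curve_large (c : ℝ) (hc : 1 < |c|) :
    let ε : ℝ := if 1 < c then 1 else -1
    let μ : ℝ := Real.sqrt (c ^ 2 - 1)
    let x : ℝ → ℝ := fun s =>
      2 * ε * arctan (Real.sqrt ((c - 1) / (c + 1)) * tan (μ * s / 2)) - c * s
    let y : ℝ → ℝ := fun s =>
      -log ((tan (μ * s / 2) ^ 2 + 1) / ((c - 1) / (c + 1) * tan (μ * s / 2) ^ 2 + 1))
    ∀ s ∈ Set.Ioo (-(π / μ)) (π / μ),
      deriv x s ^ 2 + deriv y s ^ 2 = 1 ∧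
      deriv x s * deriv (deriv y) s - deriv (deriv x) s * deriv y s - deriv x s = c := by
  intro ε μ x y s hs
  have hq : 0 < c ^ 2 - 1 := by
    have := (one_lt_sq_iff_one_lt_abs c).mpr hc
    linarith
  have hμ : 0 < μ := sqrt_pos.mpr hq
  have hμsq : μ ^ 2 = c ^ 2 - 1 := sq_sqrt hq.le
  have hcos : ∀ u ∈ Set.Ioo (-(π / μ)) (π / μ), cos (μ * u / 2) ≠ 0 := by
    rintro u ⟨hl, hr⟩
    rw [← neg_div, div_lt_iff₀ hμ] at hl
    rw [lt_div_iff₀ hμ] at hr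
    exact (cos_pos_of_mem_Ioo ⟨by linarith, by linarith⟩).ne'
  have hx : ∀ u ∈ Set.Ioo (-(π / μ)) (π / μ), deriv x u = μ ^ 2 / (c + cos (μ * u)) - c :=
    fun u hu => (hasDerivAt_mul_arctan_mul_tan_half hc rfl (hcos u hu)).deriv
  have hy : ∀ u ∈ Set.Ioo (-(π / μ)) (π / μ),
      deriv y u = -(μ * sin (μ * u)) / (c + cos (μ * u)) :=
    fun u hu => (hasDerivAt_neg_log_tan_half hc (hcos u hu)).deriv
  have hnhds : Set.Ioo (-(π / μ)) (π / μ) ∈ nhds s := isOpen_Ioo.mem_nhds hs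
  have hden := add_cos_ne_zero_of_one_lt_abs hc (μ * s)
  have hlin : HasDerivAt (fun u : ℝ => μ * u) μ s := by
    simpa using (hasDerivAt_id s).const_mul μ
  have hxx : deriv (deriv x) s = μ ^ 3 * sin (μ * s) / (c + cos (μ * s)) ^ 2 := by
    rw [(Filter.eventuallyEq_of_mem hnhds hx).deriv_eq]
    refine HasDerivAt.deriv ((((hasDerivAt_const s (μ ^ 2)).div
      (hlin.cos.const_add c) hden).sub_const c).congr_deriv ?_)
    ring
  have hyy : deriv (deriv y) s = -(μ ^ 2 * (1 + c * cos (μ * s))) / (c + cos (μ * s)) ^ 2 := by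
    rw [(Filter.eventuallyEq_of_mem hnhds hy).deriv_eq]
    refine HasDerivAt.deriv (((hlin.sin.const_mul μ).neg.div
      (hlin.cos.const_add c) hden).congr_deriv ?_)
    congr 1
    simp only [Pi.neg_apply]
    linear_combination -μ ^ 2 * sin_sq_add_cos_sq (μ * s)
  have hxs : deriv x s = -(1 + c * cos (μ * s)) / (c + cos (μ * s)) := by
    rw [hx s hs, hμsq]
    field_simp
    ring
  have hsq := sin_sq_add_cos_sq (μ * s)
  have harc : (1 + c * cos (μ * s)) ^ 2 + μ ^ 2 * sin (μ * s) ^ 2 = (c + cos (μ * s)) ^ 2 := by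
    rw [hμsq]
    linear_combination (c ^ 2 - 1) * hsq
  constructor
  · rw [hxs, hy s hs]
    field_simp
    linear_combination harc
  · rw [hxx, hyy, hy s hs, hxs]
    field_simp
    linear_combination μ ^ 2 * harc + (c + cos (μ * s)) ^ 2 * hμsq
end

section
/- Let k_c(s) = (c² − 1)/(c + cos(√(c² − 1)·s)) denote the Euclidean curvature of the arc-length-parametrized curve of constant weighted curvature c > 1 (with respect to the density e^y), defined for s ∈ (−π/√(c²−1), π/√(c²−1)). Then the curvature of the rescaled curve √(c² − 1)·α_c, namely k_c(s)/√(c² − 1) = √(c² − 1)/(c + cos(√(c² − 1)·s)), converges to 1 uniformly in s as c → ∞: for every ε > 0 there exists C > 1 such that for all c > C and all s in the domain, |√(c² − 1)/(c + cos(√(c² − 1)·s)) − 1| < ε. Thus the family of curves of constant weighted curvature c converges to a round point as c → ∞. -/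
open Real

/-- The Euclidean curvature of the rescaled curve `√(c² − 1)·α_c`, namely
`√(c² − 1)/(c + cos(√(c² − 1)·s))`, converges to `1` uniformly in `s` as `c → ∞`:
the family of curves of constant weighted curvature `c` converges to a round point. -/
theorem rescaled_curvature_tendsto_one :
    ∀ ε > (0 : ℝ), ∃ C > (1 : ℝ), ∀ c > C,
      ∀ s ∈ Set.Ioo (-(π / Real.sqrt (c ^ 2 - 1))) (π / Real.sqrt (c ^ 2 - 1)),
        |Real.sqrt (c ^ 2 - 1) / (c + cos (Real.sqrt (c ^ 2 - 1) * s)) - 1| < ε := by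
  intro ε hε
  refine ⟨1 + 2 / ε, lt_add_of_pos_right 1 (by positivity), fun c hc s _ => ?_⟩
  have hc_sub : 2 / ε < c - 1 := by linarith
  have hc_pos : 0 < c - 1 := lt_trans (by positivity) hc_sub
  have h_two : 2 < ε * (c - 1) := by rwa [div_lt_iff₀' hε] at hc_sub
  have h_sqrt_lower : c - 1 ≤ Real.sqrt (c ^ 2 - 1) := Real.le_sqrt_of_sq_le (by nlinarith)
  have h_sqrt_upper : Real.sqrt (c ^ 2 - 1) ≤ c :=
    Real.sqrt_le_iff.mpr ⟨by linarith, by linarith⟩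
  generalize Real.sqrt (c ^ 2 - 1) = r at *
  have h_cos_lower := neg_one_le_cos (r * s)
  have h_cos_upper := cos_le_one (r * s)
  have h_den : 0 < c + cos (r * s) := by linarith
  have h_bound : 2 < ε * (c + cos (r * s)) :=
    h_two.trans_le (mul_le_mul_of_nonneg_left (by linarith) hε.le)
  rw [div_sub_one h_den.ne', abs_div, abs_of_pos h_den, div_lt_iff₀ h_den]
  exact lt_of_le_of_lt (abs_le.mpr ⟨by linarith, by linarith⟩) h_bound
end

section
/- Let (a₁, b₁) ≠ (a₂, b₂) be two points of ℝ². Consider the two Grim Reaper graphs u₁(x) = b₁ − ln cos(x − a₁) on (a₁ − π/2, a₁ + π/2) and u₂(x) = b₂ − ln cos(x − a₂) on (a₂ − π/2, a₂ + π/2). Then the graphs of u₁ and u₂ have at most one common point: there is at most one x in the intersection of the two domains with u₁(x) = u₂(x). -/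
open Real

theorem cos_sub_mul_cos_sub_sub_cos_sub_mul_cos_sub (x y a b : ℝ) :
    cos (x - a) * cos (y - b) - cos (y - a) * cos (x - b) = sin (x - y) * sin (a - b) := by
  simp only [cos_sub, sin_sub]
  ring

theorem eq_of_sin_sub_eq_zero {s t : ℝ} (h : sin (s - t) = 0) (h₁ : -π < s - t)
    (h₂ : s - t < π) : s = t :=
  sub_eq_zero.mp ((sin_eq_zero_iff_of_lt_of_lt h₁ h₂).mp h)

/-- Two distinct Grim Reaper graphs `u₁(x) = b₁ − ln cos(x − a₁)` and
`u₂(x) = b₂ − ln cos(x − a₂)` have at most one common point. -/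
theorem grimReaper_graphs_intersect_at_most_once (a₁ b₁ a₂ b₂ : ℝ)
    (hne : (a₁, b₁) ≠ (a₂, b₂)) :
    ∀ x ∈ Set.Ioo (a₁ - π / 2) (a₁ + π / 2) ∩ Set.Ioo (a₂ - π / 2) (a₂ + π / 2),
    ∀ x' ∈ Set.Ioo (a₁ - π / 2) (a₁ + π / 2) ∩ Set.Ioo (a₂ - π / 2) (a₂ + π / 2),
      b₁ - log (cos (x - a₁)) = b₂ - log (cos (x - a₂)) →
      b₁ - log (cos (x' - a₁)) = b₂ - log (cos (x' - a₂)) →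
      x = x' := by
  rintro x ⟨⟨hx₁, hx₁'⟩, hx₂, hx₂'⟩ y ⟨⟨hy₁, hy₁'⟩, hy₂, hy₂'⟩ hx hy
  have cx₁ : 0 < cos (x - a₁) := cos_pos_of_mem_Ioo ⟨by linarith, by linarith⟩
  have cx₂ : 0 < cos (x - a₂) := cos_pos_of_mem_Ioo ⟨by linarith, by linarith⟩
  have cy₁ : 0 < cos (y - a₁) := cos_pos_of_mem_Ioo ⟨by linarith, by linarith⟩
  have cy₂ : 0 < cos (y - a₂) := cos_pos_of_mem_Ioo ⟨by linarith, by linarith⟩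
  have hcos : cos (x - a₁) * cos (y - a₂) = cos (y - a₁) * cos (x - a₂) := by
    apply log_injOn_pos (mul_pos cx₁ cy₂) (mul_pos cy₁ cx₂)
    rw [log_mul cx₁.ne' cy₂.ne', log_mul cy₁.ne' cx₂.ne']
    linarith
  have hsin : sin (x - y) * sin (a₁ - a₂) = 0 := by
    rw [← cos_sub_mul_cos_sub_sub_cos_sub_mul_cos_sub, hcos, sub_self]
  rcases mul_eq_zero.mp hsin with h | h
  · exact eq_of_sin_sub_eq_zero h (by linarith) (by linarith)
  · obtain rfl : a₁ = a₂ := eq_of_sin_sub_eq_zero h (by linarith) (by linarith)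
    exact (hne (Prod.ext rfl (sub_left_injective hx))).elim
end

section
/- Let p = (p₁, p₂) and q = (q₁, q₂) be distinct points of ℝ² with |p₁ − q₁| ≥ π. Then there is no C² curve α : [0, L] → ℝ² parametrized by arc length with α(0) = p, α(L) = q, and weighted curvature identically zero (x'(s)y''(s) − x''(s)y'(s) − x'(s) = 0 for all s ∈ [0, L]). That is, no geodesic of the plane with density e^y connects two points whose x-coordinates differ by at least π. -/
open Real

/-- A continuous function on `[a, b]` with zero derivative in the interior takes the same value
at both endpoints. -/
theorem eq_of_hasDerivAt_zero_Ioo {f : ℝ → ℝ} {a b : ℝ} (hab : a ≤ b)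
    (hf : ContinuousOn f (Set.Icc a b)) (hf' : ∀ s ∈ Set.Ioo a b, HasDerivAt f 0 s) :
    f b = f a := by
  rcases hab.eq_or_lt with rfl | hlt
  · rfl
  obtain ⟨c, -, hc⟩ := exists_hasDerivAt_eq_slope f (fun _ => 0) hlt hf hf'
  rw [eq_comm, div_eq_zero_iff] at hc
  rcases hc with hc | hc <;> linarith

section Geodesic

variable {x y u v u' v' : ℝ → ℝ} {L : ℝ}

/-- Along a unit-speed geodesic of the plane with density `e^y`, the horizontal velocity
satisfies `x'' = -x' y'` in the interior of the interval of definition. -/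
theorem geodesic_horizontal_acceleration
    (hu : ∀ s, HasDerivAt u (u' s) s) (hv : ∀ s, HasDerivAt v (v' s) s)
    (hunit : ∀ s ∈ Set.Icc 0 L, u s ^ 2 + v s ^ 2 = 1)
    (hcurv : ∀ s ∈ Set.Icc 0 L, u s * v' s - u' s * v s - u s = 0)
    {s : ℝ} (hs : s ∈ Set.Ioo 0 L) : u' s = -(u s * v s) := by
  have hd := ((hu s).pow 2).add ((hv s).pow 2)
  have hconst : (u ^ 2 + v ^ 2) =ᶠ[nhds s] fun _ => (1 : ℝ) := by
    filter_upwards [Icc_mem_nhds hs.1 hs.2] with t ht using hunit t ht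
  have horth := hd.unique ((hasDerivAt_const s (1 : ℝ)).congr_of_eventuallyEq hconst)
  norm_num at horth
  have hmem := Set.Ioo_subset_Icc_self hs
  linear_combination (-u' s) * hunit s hmem + (u s / 2) * horth - v s * hcurv s hmem

/-- The quantity `e^y x'` is conserved along unit-speed geodesics of the plane with
density `e^y`. -/
theorem geodesic_exp_mul_velocity_eq
    (hy : ∀ s, HasDerivAt y (v s) s)
    (hu : ∀ s, HasDerivAt u (u' s) s) (hv : ∀ s, HasDerivAt v (v' s) s)
    (hunit : ∀ s ∈ Set.Icc 0 L, u s ^ 2 + v s ^ 2 = 1)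
    (hcurv : ∀ s ∈ Set.Icc 0 L, u s * v' s - u' s * v s - u s = 0)
    {s : ℝ} (hs : s ∈ Set.Icc 0 L) : exp (y s) * u s = exp (y 0) * u 0 := by
  have hd : ∀ t, HasDerivAt (fun t => exp (y t) * u t)
      (exp (y t) * v t * u t + exp (y t) * u' t) t := fun t => (hy t).exp.mul (hu t)
  refine eq_of_hasDerivAt_zero_Ioo (f := fun t => exp (y t) * u t) hs.1
    (fun t _ => (hd t).continuousAt.continuousWithinAt) fun t ht => ?_
  have hacc := geodesic_horizontal_acceleration hu hv hunit hcurv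
    (Set.Ioo_subset_Ioo_right hs.2 ht)
  convert hd t using 1
  rw [hacc]
  ring

/-- The horizontal displacement along a unit-speed geodesic of the plane with density `e^y` is
less than `π`. -/
theorem abs_sub_lt_pi_of_geodesic (hL : 0 < L)
    (hx : ∀ s, HasDerivAt x (u s) s) (hy : ∀ s, HasDerivAt y (v s) s)
    (hu : ∀ s, HasDerivAt u (u' s) s) (hv : ∀ s, HasDerivAt v (v' s) s)
    (hunit : ∀ s ∈ Set.Icc 0 L, u s ^ 2 + v s ^ 2 = 1)
    (hcurv : ∀ s ∈ Set.Icc 0 L, u s * v' s - u' s * v s - u s = 0) :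
    |x L - x 0| < π := by
  have hcons : ∀ s ∈ Set.Icc 0 L, exp (y s) * u s = exp (y 0) * u 0 := fun s hs =>
    geodesic_exp_mul_velocity_eq hy hu hv hunit hcurv hs
  have hxc : Continuous x := continuous_iff_continuousAt.2 fun s => (hx s).continuousAt
  by_cases hu0 : u 0 = 0
  · have hconst : x L = x 0 := eq_of_hasDerivAt_zero_Ioo hL.le hxc.continuousOn fun s hs => by
      have hus : u s = 0 := by
        simpa [hu0, (exp_pos (y s)).ne'] using hcons s (Set.Ioo_subset_Icc_self hs)
      exact hus ▸ hx s
    simpa [hconst] using pi_pos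
  · have hne : ∀ s ∈ Set.Icc 0 L, u s ≠ 0 := fun s hs hus => by
      have := hcons s hs
      simp [hus, hu0, (exp_pos (y 0)).ne'] at this
    -- The tangent angle `arctan (v / u)` and `x` have the same derivative.
    have hd : ∀ s ∈ Set.Icc 0 L, HasDerivAt (fun t => x t - arctan (v t / u t)) 0 s := by
      intro s hs
      have hn := hne s hs
      refine ((hx s).sub ((hv s).div (hu s) hn).arctan).congr_deriv ?_
      have hangle : 1 + (v s / u s) ^ 2 = 1 / u s ^ 2 := by
        field_simp
        exact hunit s hs
      rw [Pi.div_apply, hangle]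
      field_simp
      linear_combination -hcurv s hs
    have heq := eq_of_hasDerivAt_zero_Ioo hL.le
      (fun s hs => (hd s hs).continuousAt.continuousWithinAt)
      fun s hs => hd s (Set.Ioo_subset_Icc_self hs)
    rw [abs_lt]
    constructor <;>
    linarith [arctan_lt_pi_div_two (v L / u L), neg_pi_div_two_lt_arctan (v L / u L),
      arctan_lt_pi_div_two (v 0 / u 0), neg_pi_div_two_lt_arctan (v 0 / u 0)]

end Geodesic

/-- No geodesic of the plane with density `e^y` (i.e. no unit-speed `C²` curve of zero
weighted curvature) connects two points whose `x`-coordinates differ by at least `π`.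
(The curve on `[0, L]` is represented by a `C²` extension to all of `ℝ`.) -/
theorem no_geodesic_between_far_points (p q : ℝ × ℝ) (hpq : p ≠ q)
    (hfar : π ≤ |p.1 - q.1|) :
    ¬ ∃ (L : ℝ) (_ : 0 < L) (x y : ℝ → ℝ),
      ContDiff ℝ 2 x ∧ ContDiff ℝ 2 y ∧
      (∀ s ∈ Set.Icc (0 : ℝ) L, deriv x s ^ 2 + deriv y s ^ 2 = 1) ∧
      (∀ s ∈ Set.Icc (0 : ℝ) L,
        deriv x s * deriv (deriv y) s - deriv (deriv x) s * deriv y s - deriv x s = 0) ∧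
      (x 0, y 0) = p ∧ (x L, y L) = q := by
  rintro ⟨L, hL, x, y, hx, hy, hunit, hcurv, h0, hend⟩
  subst h0 hend
  have hxd : ∀ s, HasDerivAt x (deriv x s) s := fun s =>
    (hx.differentiable (by norm_num) s).hasDerivAt
  have hyd : ∀ s, HasDerivAt y (deriv y s) s := fun s =>
    (hy.differentiable (by norm_num) s).hasDerivAt
  have hxdd : ∀ s, HasDerivAt (deriv x) (deriv (deriv x) s) s := fun s =>
    (((contDiff_succ_iff_deriv (n := 1)).1 hx).2.2.differentiable (by norm_num) s).hasDerivAt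
  have hydd : ∀ s, HasDerivAt (deriv y) (deriv (deriv y) s) s := fun s =>
    (((contDiff_succ_iff_deriv (n := 1)).1 hy).2.2.differentiable (by norm_num) s).hasDerivAt
  have hlt := abs_sub_lt_pi_of_geodesic hL hxd hyd hxdd hydd hunit hcurv
  rw [abs_sub_comm] at hlt
  exact absurd hfar (not_le.2 hlt)
end

section
/- Let p = (p₁, p₂) and q = (q₁, q₂) be points of ℝ² with 0 < |p₁ − q₁| < π. Then there exists a unique pair (a, b) ∈ ℝ² such that both p and q lie on the Grim Reaper graph of u(x) = b − ln cos(x − a), x ∈ (a − π/2, a + π/2): i.e. p₁, q₁ ∈ (a − π/2, a + π/2), p₂ = b − ln cos(p₁ − a) and q₂ = b − ln cos(q₁ − a). -/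
open Real

theorem sin_ne_zero_of_abs_lt_pi {d : ℝ} (h0 : 0 < |d|) (hπ : |d| < π) : sin d ≠ 0 := by
  have h := abs_lt.mp hπ
  exact fun hs => abs_pos.mp h0 ((sin_eq_zero_iff_of_lt_of_lt h.1 h.2).mp hs)

/-- On `(-π/2, π/2)`, the equation `cos (x + d) = K cos x` is solved exactly by
`x = arctan ((cos d - K) / sin d)`. -/
theorem cos_add_eq_mul_cos_iff {d K x : ℝ} (hd : sin d ≠ 0)
    (hx : x ∈ Set.Ioo (-(π / 2)) (π / 2)) :
    cos (x + d) = K * cos x ↔ x = arctan ((cos d - K) / sin d) := by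
  have hc : cos x ≠ 0 := (cos_pos_of_mem_Ioo hx).ne'
  have htan : cos (x + d) = K * cos x ↔ tan x = (cos d - K) / sin d := by
    rw [cos_add, tan_eq_sin_div_cos, div_eq_div_iff hc hd]
    constructor <;> intro h <;> linarith
  rw [htan]
  constructor
  · intro h
    rw [← h, arctan_tan hx.1 hx.2]
  · intro h
    rw [h, tan_arctan]

theorem mem_Ioo_of_cos_pos {y : ℝ} (hl : -(3 * π / 2) < y) (hu : y < 3 * π / 2)
    (hy : 0 < cos y) : y ∈ Set.Ioo (-(π / 2)) (π / 2) := by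
  constructor
  · by_contra! h
    have := cos_nonpos_of_pi_div_two_le_of_le (x := -y) (by linarith) (by linarith)
    rw [cos_neg] at this
    linarith
  · by_contra! h
    have := cos_nonpos_of_pi_div_two_le_of_le h (by linarith)
    linarith

/-- If the `x`-coordinates of two points `p, q` differ by a positive amount less than `π`,
then there is a unique Grim Reaper graph `u(x) = b − ln cos(x − a)` on
`(a − π/2, a + π/2)` passing through both points. -/
theorem unique_grimReaper_graph_through_two_points (p q : ℝ × ℝ)
    (h0 : 0 < |p.1 - q.1|) (hπ : |p.1 - q.1| < π) :
    ∃! ab : ℝ × ℝ,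
      p.1 ∈ Set.Ioo (ab.1 - π / 2) (ab.1 + π / 2) ∧
      q.1 ∈ Set.Ioo (ab.1 - π / 2) (ab.1 + π / 2) ∧
      p.2 = ab.2 - log (cos (p.1 - ab.1)) ∧
      q.2 = ab.2 - log (cos (q.1 - ab.1)) := by
  have hd0 : 0 < |q.1 - p.1| := by rwa [abs_sub_comm]
  have hdπ : |q.1 - p.1| < π := by rwa [abs_sub_comm]
  have hs := sin_ne_zero_of_abs_lt_pi hd0 hdπ
  obtain ⟨hd1, hd2⟩ := abs_lt.mp hdπ
  set x := arctan ((cos (q.1 - p.1) - exp (p.2 - q.2)) / sin (q.1 - p.1)) with hx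
  have hxm : x ∈ Set.Ioo (-(π / 2)) (π / 2) := arctan_mem_Ioo _
  have hcos : cos (x + (q.1 - p.1)) = exp (p.2 - q.2) * cos x :=
    (cos_add_eq_mul_cos_iff hs hxm).mpr hx
  have hcx : 0 < cos x := cos_pos_of_mem_Ioo hxm
  have hym := mem_Ioo_of_cos_pos (y := x + (q.1 - p.1)) (by linarith [hxm.1])
    (by linarith [hxm.2]) (by rw [hcos]; positivity)
  refine ⟨(p.1 - x, p.2 + log (cos x)), ⟨?_, ?_, ?_, ?_⟩, ?_⟩
  · exact ⟨by linarith [hxm.1], by linarith [hxm.2]⟩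
  · exact ⟨by linarith [hym.1], by linarith [hym.2]⟩
  · simp
  · have hq : q.1 - (p.1 - x) = x + (q.1 - p.1) := by ring
    simp only [hq, hcos, log_mul (exp_pos _).ne' hcx.ne', log_exp]
    ring
  · rintro ⟨a, b⟩ ⟨hpm, hqm, hp, hq⟩
    simp only at hpm hqm hp hq
    have hpm' : p.1 - a ∈ Set.Ioo (-(π / 2)) (π / 2) :=
      ⟨by linarith [hpm.1], by linarith [hpm.2]⟩
    have hqm' : q.1 - a ∈ Set.Ioo (-(π / 2)) (π / 2) :=
      ⟨by linarith [hqm.1], by linarith [hqm.2]⟩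
    have hpa : p.1 - a = x := by
      refine (cos_add_eq_mul_cos_iff hs hpm').mp ?_
      have hdiff : p.2 - q.2 = log (cos (q.1 - a)) - log (cos (p.1 - a)) := by linarith
      have hcp := cos_pos_of_mem_Ioo hpm'
      rw [hdiff, exp_sub, exp_log (cos_pos_of_mem_Ioo hqm'), exp_log hcp,
        div_mul_cancel₀ _ hcp.ne']
      congr 1
      ring
    rw [hpa] at hp
    exact Prod.ext (by simp only; linarith) (by simp only; linarith)
end
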